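/- In the minimum-counterexample setup, for every acyclic edge coloring c of G−xy using Δ+1 colors and every color γ ∈ F'_x(c), say γ = c(x,w) where w is a degree-2 neighbor of x with w ≠ y, there exists a (ν,γ,x,y')-maximal bichromatic path with respect to the partial coloring c_γ obtained from c by uncoloring the edge xw, where ν is the element of F''_x(c) other than c(y,y'). -/

import Mathlib

open SimpleGraph

namespace AEC

variable {V : Type*}

/-- The set of colors appearing (under partial coloring `c`) on colored edges incident
with the vertex `u` (i.e. `F_u`). -/
def colorsAt (G : SimpleGraph V) (c : Sym2 V → Option ℕ) (u : V) : Set ℕ :=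
  {γ | ∃ z, G.Adj u z ∧ c s(u, z) = some γ}

/-- `S_ab`: the set of colors appearing on the colored edges incident with `b`
other than the edge `ab`. -/
def Sset (G : SimpleGraph V) (c : Sym2 V → Option ℕ) (a b : V) : Set ℕ :=
  {γ | ∃ z, G.Adj b z ∧ z ≠ a ∧ c s(b, z) = some γ}

/-- A partial edge coloring (colors are `ℕ`, `none` = uncolored): it may only color
edges of `G`, and colored edges sharing an endpoint receive distinct colors. -/
def ProperPartialColoring (G : SimpleGraph V) (c : Sym2 V → Option ℕ) : Prop :=
  (∀ e, (c e).isSome → e ∈ G.edgeSet) ∧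
  ∀ ⦃u v w : V⦄, G.Adj u v → G.Adj u w → v ≠ w → (c s(u, v)).isSome →
    c s(u, v) ≠ c s(u, w)

/-- A valid (acyclic) partial coloring: proper, and no cycle of `G` is bichromatic,
i.e. no cycle has all of its edges colored using only two colors. -/
def AcyclicPartialColoring (G : SimpleGraph V) (c : Sym2 V → Option ℕ) : Prop :=
  ProperPartialColoring G c ∧
  ∀ (α β : ℕ) (v : V) (W : G.Walk v v), W.IsCycle →
    ¬ ∀ e ∈ W.edges, c e = some α ∨ c e = some β

/-- An acyclic edge coloring of `G` using (at most) `k` colors: a valid partial coloring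
that colors every edge of `G` with a color `< k`. -/
def IsAcyclicEdgeColoring (G : SimpleGraph V) (k : ℕ) (c : Sym2 V → Option ℕ) : Prop :=
  AcyclicPartialColoring G c ∧ ∀ e ∈ G.edgeSet, ∃ a, a < k ∧ c e = some a

/-- `G` is 2-degenerate: every nonempty (induced) subgraph has a vertex of degree at most 2. -/
def TwoDegenerate [DecidableEq V] (G : SimpleGraph V) [DecidableRel G.Adj] : Prop :=
  ∀ s : Finset V, s.Nonempty → ∃ v ∈ s, (s.filter fun u => G.Adj v u).card ≤ 2

/-- A maximal `(α,β)`-bichromatic path from `a` to `b`: a path all of whose edges are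
colored `α` or `β`, which cannot be extended at either end. -/
def IsMaximalBichromaticPath (G : SimpleGraph V) (c : Sym2 V → Option ℕ)
    (α β : ℕ) {a b : V} (W : G.Walk a b) : Prop :=
  W.IsPath ∧ (∀ e ∈ W.edges, c e = some α ∨ c e = some β) ∧
  (∀ w, G.Adj a w → (c s(a, w) = some α ∨ c s(a, w) = some β) → w ∈ W.support) ∧
  (∀ w, G.Adj b w → (c s(b, w) = some α ∨ c s(b, w) = some β) → w ∈ W.support)

/-- An `(α,β,a,b)`-maximal bichromatic path: a maximal `(α,β)`-bichromatic path from
`a` to `b` whose edge incident on `a` is colored `α`. -/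
def IsMaxBichromaticPathFrom (G : SimpleGraph V) (c : Sym2 V → Option ℕ)
    (α β : ℕ) {a b : V} (W : G.Walk a b) : Prop :=
  IsMaximalBichromaticPath G c α β W ∧ ∃ e, W.edges.head? = some e ∧ c e = some α

/-- An `(α,β,ab)`-critical path: a maximal `(α,β)`-bichromatic path from `a` to `b` whose
edges incident on `a` and on `b` are both colored `α`. -/
def IsCriticalPath (G : SimpleGraph V) (c : Sym2 V → Option ℕ)
    (α β : ℕ) {a b : V} (W : G.Walk a b) : Prop :=
  IsMaxBichromaticPathFrom G c α β W ∧ ∃ e, W.edges.getLast? = some e ∧ c e = some α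

/-- `F''_x(c)`: colors of edges from `x` to its neighbors (other than `y`) of degree ≥ 3. -/
def Fpp [Fintype V] (G : SimpleGraph V) [DecidableRel G.Adj]
    (c : Sym2 V → Option ℕ) (x y : V) : Set ℕ :=
  {γ | ∃ z, G.Adj x z ∧ z ≠ y ∧ 3 ≤ G.degree z ∧ c s(x, z) = some γ}

/-- `F'_x(c)`: colors of edges from `x` to its neighbors (other than `y`) of degree 2. -/
def Fp [Fintype V] (G : SimpleGraph V) [DecidableRel G.Adj]
    (c : Sym2 V → Option ℕ) (x y : V) : Set ℕ :=
  {γ | ∃ z, G.Adj x z ∧ z ≠ y ∧ G.degree z = 2 ∧ c s(x, z) = some γ}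

/-- `F_x(c) = F'_x(c) ∪ F''_x(c)`. -/
def Fx [Fintype V] (G : SimpleGraph V) [DecidableRel G.Adj]
    (c : Sym2 V → Option ℕ) (x y : V) : Set ℕ :=
  Fp G c x y ∪ Fpp G c x y


/-- The spanning graph formed by the edges coloured `α` or `β`. -/
def bichromaticGraph (c : Sym2 V → Option ℕ) (α β : ℕ) : SimpleGraph V where
  Adj u v := u ≠ v ∧ (c s(u, v) = some α ∨ c s(u, v) = some β)
  symm := ⟨fun u v h => ⟨h.1.symm, by rw [Sym2.eq_swap]; exact h.2⟩⟩
  loopless := ⟨fun _ h => h.1 rfl⟩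

theorem bichromaticGraph_comm (c : Sym2 V → Option ℕ) (α β : ℕ) :
    bichromaticGraph c α β = bichromaticGraph c β α := by
  ext u v
  simp only [bichromaticGraph, or_comm]

/-- Properness and acyclicity of a partial colouring, without reference to a host graph. -/
structure IsAcyclicColoring (c : Sym2 V → Option ℕ) : Prop where
  proper : ∀ ⦃u v w : V⦄ ⦃a : ℕ⦄, c s(u, v) = some a → c s(u, w) = some a → v = w
  acyclic : ∀ α β, (bichromaticGraph c α β).IsAcyclic

/-- An acyclic colouring that colours exactly the edges of `H`, with colours below `k`. -/
structure IsFullAcyclicColoring (H : SimpleGraph V) (k : ℕ) (c : Sym2 V → Option ℕ) : Prop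
    extends IsAcyclicColoring c where
  adj : ∀ ⦃u v : V⦄ ⦃a : ℕ⦄, c s(u, v) = some a → H.Adj u v
  lt : ∀ ⦃u v : V⦄ ⦃a : ℕ⦄, c s(u, v) = some a → a < k
  colored : ∀ ⦃u v : V⦄, H.Adj u v → ∃ a, c s(u, v) = some a

theorem isFullAcyclicColoring_of_isAcyclicEdgeColoring {H : SimpleGraph V} {k : ℕ}
    {c : Sym2 V → Option ℕ} (h : IsAcyclicEdgeColoring H k c) :
    IsFullAcyclicColoring H k c := by
  obtain ⟨⟨⟨hdom, hprop⟩, hcyc⟩, hcol⟩ := h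
  have hadj : ∀ ⦃u v : V⦄ ⦃a : ℕ⦄, c s(u, v) = some a → H.Adj u v := fun u v a h =>
    hdom s(u, v) (by rw [h]; rfl)
  refine ⟨⟨fun u v w a h₁ h₂ => ?_, fun α β v p hp => ?_⟩, hadj, fun u v a h => ?_,
    fun u v h => ?_⟩
  · by_contra hne
    exact hprop (hadj h₁) (hadj h₂) hne (by rw [h₁]; rfl) (h₁.trans h₂.symm)
  · have hle : bichromaticGraph c α β ≤ H := fun a b hab => hab.2.elim (hadj ·) (hadj ·)
    refine hcyc α β v (p.mapLe hle) ((Walk.isCycle_mapLe hle).2 hp) fun e he => ?_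
    rw [Walk.edges_mapLe_eq_edges] at he
    have := p.edges_subset_edgeSet he
    induction e with
    | _ a b => exact this.2
  · obtain ⟨b, hb, hb'⟩ := hcol s(u, v) (hadj h)
    simp_all
  · obtain ⟨b, hb, hb'⟩ := hcol s(u, v) h
    exact ⟨b, hb'⟩

theorem IsFullAcyclicColoring.isAcyclicEdgeColoring {H : SimpleGraph V} {k : ℕ}
    {c : Sym2 V → Option ℕ} (h : IsFullAcyclicColoring H k c) :
    IsAcyclicEdgeColoring H k c := by
  refine ⟨⟨⟨fun e he => ?_, fun u v w _ _ hvw hs heq => ?_⟩, fun α β v p hp hall => ?_⟩,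
    fun e he => ?_⟩
  · induction e with
    | _ a b =>
      obtain ⟨i, hi⟩ := Option.isSome_iff_exists.1 he
      exact h.adj hi
  · obtain ⟨i, hi⟩ := Option.isSome_iff_exists.1 hs
    exact hvw (h.proper hi (heq ▸ hi))
  · have hsub : ∀ e ∈ p.edges, e ∈ (bichromaticGraph c α β).edgeSet := fun e he => by
      have h₁ := hall e he
      have h₂ := p.edges_subset_edgeSet he
      induction e with
      | _ a b => exact ⟨h₂.ne, h₁⟩
    exact h.acyclic α β _ (hp.transfer hsub)
  · induction e with
    | _ a b =>
      obtain ⟨i, hi⟩ := h.colored he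
      exact ⟨i, h.lt hi, hi⟩

theorem mem_of_reachable {H : SimpleGraph V} {S : Set V} {a b : V} (h : H.Reachable a b)
    (ha : a ∈ S) (hS : ∀ u v, u ∈ S → H.Adj u v → v ∈ S) : b ∈ S := by
  rw [reachable_iff_reflTransGen] at h
  induction h with
  | refl => exact ha
  | tail _ hbc ih => exact hS _ _ ih hbc

/-- Walks can avoid a vertex `y` with at most one neighbour `y'`. -/
theorem reachable_of_pendant {H H' : SimpleGraph V} {x y y' : V} (hxy : x ≠ y)
    (hy : ∀ z, H.Adj y z → z = y')
    (hle : ∀ u v, u ≠ y → v ≠ y → H.Adj u v → H'.Adj u v) {z : V} (h : H.Reachable x z) :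
    (z ≠ y → H'.Reachable x z) ∧ (z = y → H'.Reachable x y') := by
  rw [reachable_iff_reflTransGen] at h
  induction h with
  | refl => exact ⟨fun _ => .rfl, fun h => absurd h hxy⟩
  | @tail b d _ hbd ih =>
    by_cases hb : b = y
    · subst hb
      obtain rfl := hy _ hbd
      exact ⟨fun _ => ih.2 rfl, fun h => absurd h hbd.ne'⟩
    · refine ⟨fun hd => (ih.1 hb).trans (hle _ _ hb hd hbd).reachable, fun hd => ?_⟩
      subst hd
      obtain rfl := hy _ hbd.symm
      exact ih.1 hb

/-- In a graph of maximum degree at most two, a component has at most two vertices of degree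
at most one. -/
theorem not_reachable_of_three_leaves {H : SimpleGraph V}
    (hdeg : ∀ z a b d, H.Adj z a → H.Adj z b → H.Adj z d → a = b ∨ a = d ∨ b = d)
    {x u v : V} (hxu : x ≠ u) (hxv : x ≠ v) (huv : u ≠ v)
    (hx : ∀ a b, H.Adj x a → H.Adj x b → a = b)
    (hu : ∀ a b, H.Adj u a → H.Adj u b → a = b)
    (hv : ∀ a b, H.Adj v a → H.Adj v b → a = b)
    (h₁ : H.Reachable x u) (h₂ : H.Reachable x v) : False := by
  obtain ⟨p, hp⟩ := (h₁.symm.trans h₂).exists_isPath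
  have hnil : ¬ p.Nil := fun h => huv h.eq
  have hint : ∀ z ∈ p.support, z ≠ u → z ≠ v → ∃ a ∈ p.support, ∃ b ∈ p.support,
      H.Adj z a ∧ H.Adj z b ∧ a ≠ b := by
    intro z hz hzu hzv
    obtain ⟨i, rfl, hi⟩ := Walk.mem_support_iff_exists_getVert.1 hz
    have hi0 : i ≠ 0 := by rintro rfl; simp at hzu
    have hil : i ≠ p.length := by rintro rfl; simp at hzv
    refine ⟨p.getVert (i - 1), p.getVert_mem_support _, p.getVert (i + 1),
      p.getVert_mem_support _, ?_, p.adj_getVert_succ (by omega), fun h => ?_⟩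
    · have := p.adj_getVert_succ (i := i - 1) (by omega)
      rw [Nat.sub_add_cancel (by omega)] at this
      exact this.symm
    · have := hp.getVert_injOn (by simp; omega) (by simp; omega) h
      omega
  have hmem : x ∈ {z | z ∈ p.support} := by
    refine mem_of_reachable h₁.symm p.start_mem_support fun z t hz hzt => ?_
    by_cases hzu : z = u
    · subst hzu
      rw [hu _ _ hzt (p.adj_snd hnil)]
      exact p.getVert_mem_support _
    by_cases hzv : z = v
    · subst hzv
      rw [hv _ _ hzt (p.adj_penultimate hnil).symm]
      exact p.getVert_mem_support _
    obtain ⟨a, ha, b, hb, hza, hzb, hab⟩ := hint z hz hzu hzv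
    rcases hdeg _ _ _ _ hzt hza hzb with h | h | h
    · exact h ▸ ha
    · exact h ▸ hb
    · exact absurd h hab
  obtain ⟨a, _, b, _, ha, hb, hab⟩ := hint x hmem hxu hxv
  exact hab (hx _ _ ha hb)

theorem IsAcyclicColoring.eq_or_eq_or_eq {c : Sym2 V → Option ℕ} (hc : IsAcyclicColoring c)
    {α β : ℕ} (z a b d : V) (ha : (bichromaticGraph c α β).Adj z a)
    (hb : (bichromaticGraph c α β).Adj z b) (hd : (bichromaticGraph c α β).Adj z d) :
    a = b ∨ a = d ∨ b = d := by
  have := hc.proper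
  rcases ha.2 with h₁ | h₁ <;> rcases hb.2 with h₂ | h₂ <;> rcases hd.2 with h₃ | h₃ <;> grind

/-- The colouring `c` with the edge `uv` given the (possibly absent) colour `o`. -/
def recolor [DecidableEq V] (c : Sym2 V → Option ℕ) (u v : V) (o : Option ℕ) :
    Sym2 V → Option ℕ :=
  Function.update c s(u, v) o

theorem recolor_apply [DecidableEq V] (c : Sym2 V → Option ℕ) (u v : V) (o : Option ℕ)
    (a b : V) : recolor c u v o s(a, b) =
      if a = u ∧ b = v ∨ a = v ∧ b = u then o else c s(a, b) := by
  simp [recolor, Function.update_apply]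

theorem IsAcyclicColoring.recolor_none [DecidableEq V] {c : Sym2 V → Option ℕ}
    (hc : IsAcyclicColoring c) (u v : V) : IsAcyclicColoring (recolor c u v none) := by
  have key : ∀ a b i, recolor c u v none s(a, b) = some i → c s(a, b) = some i := by
    intro a b i h
    rw [recolor_apply] at h
    split_ifs at h
    exact h
  refine ⟨fun a b d i h₁ h₂ => hc.proper (key _ _ _ h₁) (key _ _ _ h₂), fun α β => ?_⟩
  have hle : bichromaticGraph (recolor c u v none) α β ≤ bichromaticGraph c α β :=
    fun a b h => ⟨h.1, h.2.imp (key _ _ _) (key _ _ _)⟩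
  exact (hc.acyclic α β).anti hle

theorem IsAcyclicColoring.recolor_some [DecidableEq V] {c : Sym2 V → Option ℕ}
    (hc : IsAcyclicColoring c) {u v : V} {α : ℕ}
    (hu : ∀ z, c s(u, z) ≠ some α) (hv : ∀ z, c s(v, z) ≠ some α)
    (hr : ∀ β, ¬ (bichromaticGraph c α β).Reachable u v) :
    IsAcyclicColoring (recolor c u v (some α)) := by
  have hr' : ∀ β, ¬ (bichromaticGraph c β α).Reachable u v := fun β => by
    rw [bichromaticGraph_comm]; exact hr β
  refine ⟨fun a b d i h₁ h₂ => ?_, fun σ ρ => ?_⟩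
  · rw [recolor_apply] at h₁ h₂
    have := @hc.proper
    grind
  · by_cases hα : α = σ ∨ α = ρ
    · have hnr : ¬ (bichromaticGraph c σ ρ).Reachable u v := by
        rcases hα with rfl | rfl
        · exact hr _
        · exact hr' _
      refine ((hc.acyclic σ ρ).sup_edge_of_not_reachable hnr).anti fun a b h => ?_
      obtain ⟨hne, h⟩ := h
      rw [sup_adj, edge_adj]
      rw [recolor_apply] at h
      by_cases hab : a = u ∧ b = v ∨ a = v ∧ b = u
      · exact .inr ⟨by tauto, hne⟩
      · rw [if_neg hab] at h
        exact .inl ⟨hne, h⟩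
    · refine (hc.acyclic σ ρ).anti fun a b h => ?_
      obtain ⟨hne, h⟩ := h
      refine ⟨hne, ?_⟩
      rw [recolor_apply] at h
      split_ifs at h
      · simp_all
      · exact h

theorem not_reachable_of_isolated {H : SimpleGraph V} {x y : V} (hxy : x ≠ y)
    (hy : ∀ z, ¬ H.Adj y z) : ¬ H.Reachable x y := fun h =>
  hxy (mem_of_reachable (S := {y}) h.symm rfl fun u v hu huv => by
    rw [Set.mem_singleton_iff] at hu; subst hu; exact absurd huv (hy v))

theorem recolor_self_none_some [DecidableEq V] (c : Sym2 V → Option ℕ) (u v : V)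
    (o : Option ℕ) : recolor (recolor c u v none) u v o = recolor c u v o :=
  Function.update_idem _ _ _

/-- A pendant edge may receive any colour absent from its non-leaf end. -/
theorem IsAcyclicColoring.recolor_pendant [DecidableEq V] {c : Sym2 V → Option ℕ}
    (hc : IsAcyclicColoring c) {y y' : V} {δ : ℕ} (hne : y' ≠ y)
    (hy : ∀ z i, c s(y, z) = some i → z = y') (hδ : ∀ z, z ≠ y → c s(y', z) ≠ some δ) :
    IsAcyclicColoring (recolor c y y' (some δ)) := by
  have hy0 : ∀ z i, recolor c y y' none s(y, z) ≠ some i := by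
    intro z i h
    rw [recolor_apply] at h
    split_ifs at h with h'
    exact h' (.inl ⟨rfl, hy z i h⟩)
  rw [← recolor_self_none_some]
  refine (hc.recolor_none y y').recolor_some (fun z => hy0 z δ) (fun z h => ?_) fun β h => ?_
  · rw [recolor_apply] at h
    split_ifs at h with h'
    exact hδ z (fun hz => h' (.inr ⟨rfl, hz⟩)) h
  · exact not_reachable_of_isolated
      (H := bichromaticGraph (recolor c y y' none) δ β) hne
      (fun z hz => hz.2.elim (hy0 _ _) (hy0 _ _)) h.symm

theorem exists_isMaxBichromaticPathFrom {H : SimpleGraph V} {c : Sym2 V → Option ℕ}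
    (hc : IsAcyclicColoring c) (hadj : ∀ ⦃u v : V⦄ ⦃a : ℕ⦄, c s(u, v) = some a → H.Adj u v)
    {x y : V} {α β : ℕ} (hxy : x ≠ y) (hr : (bichromaticGraph c α β).Reachable x y)
    (hx : ∀ z, c s(x, z) ≠ some β) (hy : ∀ z, c s(y, z) ≠ some α) :
    ∃ W : H.Walk x y, IsMaxBichromaticPathFrom H c α β W := by
  obtain ⟨p, hp⟩ := hr.exists_isPath
  have hnil : ¬ p.Nil := fun h => hxy h.eq
  have hle : bichromaticGraph c α β ≤ H := fun a b hab => hab.2.elim (hadj ·) (hadj ·)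
  have hfst : c s(x, p.snd) = some α := (p.adj_snd hnil).2.resolve_right (hx _)
  have hlast : c s(y, p.penultimate) = some β :=
    (p.adj_penultimate hnil).symm.2.resolve_left (hy _)
  refine ⟨p.mapLe hle, ⟨(Walk.isPath_mapLe hle).2 hp, fun e he => ?_, fun w _ hw => ?_,
    fun w _ hw => ?_⟩, s(x, p.snd), ?_, hfst⟩
  · rw [Walk.edges_mapLe_eq_edges] at he
    have := p.edges_subset_edgeSet he
    induction e with
    | _ a b => exact this.2
  · rw [Walk.support_mapLe_eq_support, hc.proper (hw.resolve_right (hx _)) hfst]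
    exact p.getVert_mem_support _
  · rw [Walk.support_mapLe_eq_support, hc.proper (hw.resolve_left (hy _)) hlast]
    exact p.getVert_mem_support _
  · rw [Walk.edges_mapLe_eq_edges]
    cases p with
    | nil => simp at hnil
    | cons h q => simp

theorem deleteEdges_pair_adj {G : SimpleGraph V} {x y u v : V} :
    (G.deleteEdges {s(x, y)}).Adj u v ↔ G.Adj u v ∧ ¬ (u = x ∧ v = y ∨ u = y ∧ v = x) := by
  simp [deleteEdges_adj]

theorem IsFullAcyclicColoring.deleted_ne
    {G : SimpleGraph V} {x y : V} {c : Sym2 V → Option ℕ} {k : ℕ}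
    (hc : IsFullAcyclicColoring (G.deleteEdges {s(x, y)}) k c) (i : ℕ) : c s(x, y) ≠ some i :=
  fun h => (deleteEdges_pair_adj.1 (hc.adj h)).2 (.inl ⟨rfl, rfl⟩)

section Counting

variable [Fintype V] [DecidableEq V] {G : SimpleGraph V} [DecidableRel G.Adj]

/-- A set of at least `deg a` colours contains one that is missing at `a`, the edge `ab` being
disregarded. -/
theorem exists_mem_ne_of_degree_le {c : Sym2 V → Option ℕ} {a b : V} (hab : G.Adj a b)
    (hadj : ∀ z i, c s(a, z) = some i → G.Adj a z) (s : Finset ℕ) (hs : G.degree a ≤ s.card) :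
    ∃ α ∈ s, ∀ z, z ≠ b → c s(a, z) ≠ some α := by
  have hlt : (((G.neighborFinset a).erase b).image fun z => c s(a, z)).card <
      (s.image some).card := by
    refine Finset.card_image_le.trans_lt ?_
    rw [Finset.card_image_of_injective _ (Option.some_injective _),
      Finset.card_erase_of_mem (by simpa using hab), G.card_neighborFinset_eq_degree]
    have : 0 < G.degree a := (G.degree_pos_iff_exists_adj a).2 ⟨b, hab⟩
    omega
  obtain ⟨o, ho, ho'⟩ := Finset.exists_mem_notMem_of_card_lt_card hlt
  obtain ⟨α, hα, rfl⟩ := Finset.mem_image.1 ho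
  refine ⟨α, hα, fun z hz h => ho' (Finset.mem_image.2 ⟨z, ?_, h⟩)⟩
  simp [hz, hadj z α h]

theorem eq_or_eq_of_degree_eq_two {y a b z : V} (hy : G.degree y = 2) (ha : G.Adj y a)
    (hb : G.Adj y b) (hab : a ≠ b) (hz : G.Adj y z) : z = a ∨ z = b := by
  have hsub : ({a, b} : Finset V) ⊆ G.neighborFinset y := by
    intro t ht
    rcases Finset.mem_insert.1 ht with rfl | ht
    · simpa using ha
    · rw [Finset.mem_singleton] at ht
      subst ht
      simpa using hb
  have heq := Finset.eq_of_subset_of_card_le hsub (by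
    rw [G.card_neighborFinset_eq_degree, hy, Finset.card_pair hab])
  have : z ∈ ({a, b} : Finset V) := heq ▸ by simpa using hz
  simpa using this

variable {x y y' : V} {c : Sym2 V → Option ℕ} {k : ℕ}

theorem IsFullAcyclicColoring.eq_of_pendant
    (hc : IsFullAcyclicColoring (G.deleteEdges {s(x, y)}) k c)
    (hy : G.degree y = 2) (hxy : G.Adj x y) (hyy' : G.Adj y y') (hy'x : y' ≠ x)
    (z : V) (i : ℕ) (h : c s(y, z) = some i) : z = y' := by
  have h' := deleteEdges_pair_adj.1 (hc.adj h)
  have := eq_or_eq_of_degree_eq_two hy hxy.symm hyy' hy'x.symm h'.1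
  tauto

/-- If `xy` cannot be given the colour `α`, a bichromatic path joins its ends. -/
theorem IsFullAcyclicColoring.reachable
    (hc : IsFullAcyclicColoring (G.deleteEdges {s(x, y)}) k c)
    (hmin : ¬ ∃ c : Sym2 V → Option ℕ, IsAcyclicEdgeColoring G k c)
    (hy : G.degree y = 2) (hxy : G.Adj x y) (hyy' : G.Adj y y') (hy'x : y' ≠ x)
    {μ α : ℕ} (hμ : c s(y, y') = some μ) (hαk : α < k) (hαμ : α ≠ μ)
    (hα : ∀ z, c s(x, z) ≠ some α) : (bichromaticGraph c μ α).Reachable x y := by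
  by_contra hnr
  have hpend := hc.eq_of_pendant hy hxy hyy' hy'x
  have hyα : ∀ z, c s(y, z) ≠ some α := fun z h => by
    obtain rfl := hpend z α h
    exact hαμ (Option.some_injective _ (h.symm.trans hμ))
  have hac : IsAcyclicColoring (recolor c x y (some α)) := by
    refine hc.toIsAcyclicColoring.recolor_some hα hyα fun β => ?_
    by_cases hβ : β = μ
    · rw [hβ, bichromaticGraph_comm]
      exact hnr
    · refine not_reachable_of_isolated hxy.ne fun z hz => hz.2.elim (hyα z) fun h => ?_
      obtain rfl := hpend z β h
      exact hβ (Option.some_injective _ (h.symm.trans hμ))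
  refine hmin ⟨_, IsFullAcyclicColoring.isAcyclicEdgeColoring
    ⟨hac, fun u v a h => ?_, fun u v a h => ?_, fun u v h => ?_⟩⟩
  · rw [recolor_apply] at h
    split_ifs at h with h'
    · rcases h' with ⟨rfl, rfl⟩ | ⟨rfl, rfl⟩
      exacts [hxy, hxy.symm]
    · exact (deleteEdges_pair_adj.1 (hc.adj h)).1
  · rw [recolor_apply] at h
    split_ifs at h with h'
    · obtain rfl := Option.some_injective _ h
      exact hαk
    · exact hc.lt h
  · rw [recolor_apply]
    split_ifs with h'
    · exact ⟨α, rfl⟩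
    · exact hc.colored (deleteEdges_pair_adj.2 ⟨h, by tauto⟩)

theorem IsFullAcyclicColoring.exists_fresh
    (hc : IsFullAcyclicColoring (G.deleteEdges {s(x, y)}) (G.maxDegree + 1) c)
    (hxy : G.Adj x y) (j : ℕ) :
    ∃ α, α < G.maxDegree + 1 ∧ α ≠ j ∧ ∀ z, c s(x, z) ≠ some α := by
  obtain ⟨α, hα, h⟩ := exists_mem_ne_of_degree_le (c := c) hxy
    (fun z i h => (deleteEdges_pair_adj.1 (hc.adj h)).1)
    ((Finset.range (G.maxDegree + 1)).erase j) (by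
      have h₁ := Finset.pred_card_le_card_erase (s := Finset.range (G.maxDegree + 1)) (a := j)
      have h₂ := G.degree_le_maxDegree x
      rw [Finset.card_range] at h₁
      omega)
  rw [Finset.mem_erase, Finset.mem_range] at hα
  refine ⟨α, hα.2, hα.1, fun z hz => ?_⟩
  by_cases hzy : z = y
  · subst hzy
    exact hc.deleted_ne α hz
  · exact h z hzy hz

/-- The colour of `yy'` also occurs on an edge from `x` to a vertex of degree at least three. -/
theorem IsFullAcyclicColoring.exists_three_le_degree
    (hc : IsFullAcyclicColoring (G.deleteEdges {s(x, y)}) (G.maxDegree + 1) c)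
    (hmin : ¬ ∃ c : Sym2 V → Option ℕ, IsAcyclicEdgeColoring G (G.maxDegree + 1) c)
    (hy : G.degree y = 2) (hxy : G.Adj x y) (hyy' : G.Adj y y') (hy'x : y' ≠ x)
    {μ : ℕ} (hμ : c s(y, y') = some μ) :
    ∃ z, G.Adj x z ∧ 3 ≤ G.degree z ∧ c s(x, z) = some μ := by
  have hreach : ∀ α, α < G.maxDegree + 1 → α ≠ μ → (∀ z, c s(x, z) ≠ some α) →
      (bichromaticGraph c μ α).Reachable x y := fun α =>
    hc.reachable hmin hy hxy hyy' hy'x hμ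
  obtain ⟨α, hαk, hαμ, hα⟩ := hc.exists_fresh hxy μ
  have hx : ∃ z, c s(x, z) = some μ := by
    by_contra! hx
    exact not_reachable_of_isolated (H := bichromaticGraph c μ α) hxy.ne'
      (fun z hz => hz.2.elim (hx z) (hα z))
      (hreach α hαk hαμ hα).symm
  obtain ⟨z, hz⟩ := hx
  have hxz := (deleteEdges_pair_adj.1 (hc.adj hz)).1
  have hzy : z ≠ y := by rintro rfl; exact hc.deleted_ne μ hz
  have hz' : c s(z, x) = some μ := by rw [Sym2.eq_swap]; exact hz
  have hnext : ∀ α, α < G.maxDegree + 1 → α ≠ μ → (∀ z, c s(x, z) ≠ some α) →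
      ∃ t, t ≠ x ∧ c s(z, t) = some α := by
    intro α hαk hαμ hα
    by_contra! hno
    have hmem : y ∈ ({x, z} : Set V) := by
      refine mem_of_reachable (hreach α hαk hαμ hα) (by simp) fun u v hu huv => ?_
      rcases hu with rfl | rfl
      · right
        exact hc.proper (huv.2.resolve_right (hα v)) hz
      · left
        rcases huv.2 with h | h
        · exact hc.proper h hz'
        · by_contra hv
          exact hno v hv h
    rcases hmem with h | h
    exacts [hxy.ne' h, hzy h.symm]
  obtain ⟨α', hαk', hαα', hα'⟩ := hc.exists_fresh hxy α
  have hαμ' : α' ≠ μ := by rintro rfl; exact hα' z hz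
  obtain ⟨t, htx, ht⟩ := hnext α hαk hαμ hα
  obtain ⟨t', htx', ht'⟩ := hnext α' hαk' hαμ' hα'
  have htt : t ≠ t' := by
    rintro rfl
    exact hαα' (Option.some_injective _ (ht'.symm.trans ht))
  refine ⟨z, hxz, ?_, hz⟩
  rw [← G.card_neighborFinset_eq_degree, ← Finset.card_eq_three.2
    ⟨x, t, t', htx.symm, htx'.symm, htt, rfl⟩]
  refine Finset.card_le_card fun v hv => ?_
  rw [mem_neighborFinset]
  simp only [Finset.mem_insert, Finset.mem_singleton] at hv
  rcases hv with rfl | rfl | rfl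
  exacts [hxz.symm, (deleteEdges_pair_adj.1 (hc.adj ht)).1, (deleteEdges_pair_adj.1 (hc.adj ht')).1]

theorem IsFullAcyclicColoring.recolor_pendant
    (hc : IsFullAcyclicColoring (G.deleteEdges {s(x, y)}) k c)
    (hy : G.degree y = 2) (hxy : G.Adj x y) (hyy' : G.Adj y y') (hy'x : y' ≠ x)
    {δ : ℕ} (hδk : δ < k) (hδ : ∀ z, z ≠ y → c s(y', z) ≠ some δ) :
    IsFullAcyclicColoring (G.deleteEdges {s(x, y)}) k (recolor c y y' (some δ)) := by
  refine ⟨hc.toIsAcyclicColoring.recolor_pendant hyy'.ne'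
    (hc.eq_of_pendant hy hxy hyy' hy'x) hδ, fun u v a h => ?_, fun u v a h => ?_,
    fun u v h => ?_⟩
  · rw [recolor_apply] at h
    split_ifs at h with h'
    · rw [deleteEdges_pair_adj]
      have := hxy.ne
      rcases h' with ⟨rfl, rfl⟩ | ⟨rfl, rfl⟩
      exacts [⟨hyy', by tauto⟩, ⟨hyy'.symm, by tauto⟩]
    · exact hc.adj h
  · rw [recolor_apply] at h
    split_ifs at h with h'
    · obtain rfl := Option.some_injective _ h
      exact hδk
    · exact hc.lt h
  · rw [recolor_apply]
    split_ifs with h'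
    · exact ⟨δ, rfl⟩
    · exact hc.colored h

end Counting

/-- Lemma 8: in the minimum-counterexample setup, for every color
`γ ∈ F'_x(c)`, say `γ = c(x,w)` with `w` a degree-2 neighbor of `x`, `w ≠ y`, there is
a `(ν,γ,x,y')`-maximal bichromatic path with respect to the coloring `c_γ` obtained from
`c` by uncoloring `xw`, where `ν` is the element of `F''_x(c)` other than `c(y,y')`. -/
theorem maxBichromaticPath_of_mem_Fp
    {V : Type*} [Fintype V] [DecidableEq V] (G : SimpleGraph V) [DecidableRel G.Adj]
    (h2deg : TwoDegenerate G)
    (hmin : ¬ ∃ c : Sym2 V → Option ℕ, IsAcyclicEdgeColoring G (G.maxDegree + 1) c)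
    (hdel : ∀ e ∈ G.edgeSet, ∃ c : Sym2 V → Option ℕ,
      IsAcyclicEdgeColoring (G.deleteEdges {e}) (G.maxDegree + 1) c)
    (x : V)
    (hxdeg2 : ∃ z, G.Adj x z ∧ G.degree z = 2)
    (hxdeg3 : ((G.neighborFinset x).filter fun z => 3 ≤ G.degree z).card ≤ 2)
    (y y' : V) (hxy : G.Adj x y) (hy2 : G.degree y = 2)
    (hyy' : G.Adj y y') (hy'x : y' ≠ x)
    (c : Sym2 V → Option ℕ)
    (hc : IsAcyclicEdgeColoring (G.deleteEdges {s(x, y)}) (G.maxDegree + 1) c)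
    (μ ν γ : ℕ) (hμ : c s(y, y') = some μ)
    (hν : ν ∈ Fpp G c x y) (hνμ : ν ≠ μ)
    (w : V) (hxw : G.Adj x w) (hwy : w ≠ y) (hw2 : G.degree w = 2)
    (hγ : c s(x, w) = some γ) :
    ∃ W : (G.deleteEdges {s(x, y)}).Walk x y',
      IsMaxBichromaticPathFrom (G.deleteEdges {s(x, y)})
        (fun e => if e = s(x, w) then none else c e) ν γ W := by
  have hF := isFullAcyclicColoring_of_isAcyclicEdgeColoring hc
  have hsome : ∀ {a b : ℕ}, (some a : Option ℕ) = some b → a = b :=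
    fun h => Option.some_injective _ h
  have hyx := hxy.ne'
  have hwx := hxw.ne'
  have hyy := hyy'.ne
  obtain ⟨q, hxq, -, hq3, hq⟩ := hν
  obtain ⟨p, hxp, hp3, hp⟩ := hF.exists_three_le_degree hmin hy2 hxy hyy' hy'x hμ
  have hbig : ∀ z, G.Adj x z → 3 ≤ G.degree z → z = p ∨ z = q := by
    intro z hz hz3
    by_contra! h
    have hpq : p ≠ q := by
      rintro rfl
      exact hνμ (hsome (hq.symm.trans hp))
    have hsub : ({z, p, q} : Finset V) ⊆ (G.neighborFinset x).filter fun z => 3 ≤ G.degree z := by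
      intro t ht
      simp only [Finset.mem_insert, Finset.mem_singleton] at ht
      rcases ht with rfl | rfl | rfl <;> simp_all
    have := Finset.card_le_card hsub
    rw [Finset.card_eq_three.2 ⟨z, p, q, h.1, h.2, hpq, rfl⟩] at this
    omega
  have hpresent : ∀ δ, δ < G.maxDegree + 1 → δ ≠ μ → δ ≠ ν →
      ∃ z, z ≠ y ∧ c s(y', z) = some δ := by
    intro δ hδk hδμ hδν
    by_contra! hno
    have hE := hF.recolor_pendant hy2 hxy hyy' hy'x hδk hno
    obtain ⟨z, hxz, hz3, hz⟩ := hE.exists_three_le_degree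
      hmin hy2 hxy hyy' hy'x (μ := δ) (by simp [recolor_apply])
    rw [recolor_apply, if_neg (by grind)] at hz
    rcases hbig z hxz hz3 with rfl | rfl
    · exact hδμ (hsome (hz.symm.trans hp))
    · exact hδν (hsome (hz.symm.trans hq))
  have hadj' : ∀ z i, c s(y', z) = some i → G.Adj y' z := fun z i h =>
    (deleteEdges_pair_adj.1 (hF.adj h)).1
  have hcard := Finset.pred_card_le_card_erase (s := Finset.range (G.maxDegree + 1)) (a := μ)
  rw [Finset.card_range] at hcard
  have hνy' : ∀ z, z ≠ y → c s(y', z) ≠ some ν := by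
    obtain ⟨α, hα, h⟩ := exists_mem_ne_of_degree_le hyy'.symm hadj'
      ((Finset.range (G.maxDegree + 1)).erase μ) (by
        have := G.degree_le_maxDegree y'
        omega)
    rw [Finset.mem_erase, Finset.mem_range] at hα
    by_cases hαν : α = ν
    · exact hαν ▸ h
    · obtain ⟨z, hzy, hz⟩ := hpresent α hα.2 hα.1 hαν
      exact absurd hz (h z hzy)
  have hμy' : ∀ z, z ≠ y → c s(y', z) ≠ some μ := fun z hzy hz =>
    hzy (hF.proper hz (by rw [Sym2.eq_swap]; exact hμ))
  have hy'3 : 3 ≤ G.degree y' := by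
    by_contra hlt
    have hcard' := Finset.pred_card_le_card_erase
      (s := (Finset.range (G.maxDegree + 1)).erase μ) (a := ν)
    have := G.degree_le_maxDegree p
    obtain ⟨α, hα, h⟩ := exists_mem_ne_of_degree_le hyy'.symm hadj'
      (((Finset.range (G.maxDegree + 1)).erase μ).erase ν) (by omega)
    simp only [Finset.mem_erase, Finset.mem_range] at hα
    obtain ⟨z, hzy, hz⟩ := hpresent α hα.2.2 hα.2.1 hα.1
    exact h z hzy hz
  have hwy' : w ≠ y' := by rintro rfl; omega
  obtain ⟨w', hw'⟩ : ((G.neighborFinset w).erase x).Nonempty := by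
    rw [← Finset.card_pos, Finset.card_erase_of_mem (by simpa using hxw.symm),
      G.card_neighborFinset_eq_degree, hw2]
    norm_num
  rw [Finset.mem_erase, mem_neighborFinset] at hw'
  obtain ⟨hw'x, hww'⟩ := hw'
  obtain ⟨τ, hτ⟩ := hF.colored (deleteEdges_pair_adj.2 ⟨hww', by grind⟩)
  have hwnbr : ∀ z i, c s(w, z) = some i → z = x ∨ z = w' := fun z i h =>
    eq_or_eq_of_degree_eq_two hw2 hxw.symm hww' hw'x.symm (deleteEdges_pair_adj.1 (hF.adj h)).1
  have hγμ : γ ≠ μ := by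
    rintro rfl
    obtain rfl := hF.proper hp hγ
    omega
  have hγν : γ ≠ ν := by
    rintro rfl
    obtain rfl := hF.proper hq hγ
    omega
  have hypend := hF.eq_of_pendant hy2 hxy hyy' hy'x
  by_contra hno
  have hle : ∀ a b i, recolor c x w none s(a, b) = some i → c s(a, b) = some i := by
    intro a b i h
    rw [recolor_apply] at h
    split_ifs at h
    exact h
  have A₁ := hF.toIsAcyclicColoring.recolor_none x w
  have hxγ : ∀ z, recolor c x w none s(x, z) ≠ some γ := by
    intro z hz
    obtain rfl := hF.proper hγ (hle _ _ _ hz)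
    simp [recolor_apply] at hz
  have A₂ := A₁.recolor_pendant hyy'.ne' (δ := ν) (fun z i h => hypend z i (hle _ _ _ h))
    (fun z hz h => hνy' z hz (hle _ _ _ h))
  have hypend₂ : ∀ z i, recolor (recolor c x w none) y y' (some ν) s(y, z) = some i →
      z = y' := by
    intro z i h
    rw [recolor_apply] at h
    split_ifs at h with h'
    · grind
    · exact hypend z i (hle _ _ _ h)
  have hnr : ∀ β, ¬ (bichromaticGraph (recolor (recolor c x w none) y y' (some ν)) γ
      β).Reachable x y := by
    intro β h
    by_cases hβ : β = ν
    · subst hβ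
      have hr := (reachable_of_pendant (H := bichromaticGraph
        (recolor (recolor c x w none) y y' (some β)) γ β)
        (H' := bichromaticGraph (recolor c x w none) β γ) hxy.ne
        (fun z hz => hz.2.elim (hypend₂ z _) (hypend₂ z _)) (fun u v hu hv huv => by
          refine ⟨huv.1, ?_⟩
          have := huv.2
          rw [recolor_apply, if_neg (by grind)] at this
          exact this.symm) h).2 rfl
      have heq : (fun e => if e = s(x, w) then none else c e) = recolor c x w none := by
        funext e
        simp [recolor, Function.update_apply]
      rw [heq] at hno
      refine hno (exists_isMaxBichromaticPathFrom A₁ (fun u v a h => hF.adj (hle _ _ _ h))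
        hy'x.symm hr hxγ fun z hz => ?_)
      by_cases hzy : z = y
      · have := hle _ _ _ hz
        rw [hzy, Sym2.eq_swap] at this
        exact hνμ (hsome (this.symm.trans hμ))
      · exact hνy' z hzy (hle _ _ _ hz)
    · refine not_reachable_of_isolated (H := bichromaticGraph
        (recolor (recolor c x w none) y y' (some ν)) γ β) hxy.ne (fun z hz => ?_) h
      obtain rfl : z = y' := hz.2.elim (hypend₂ z _) (hypend₂ z _)
      have := hz.2
      rw [recolor_apply, if_pos (by grind)] at this
      rcases this with h | h
      · exact hγν (hsome h.symm)
      · exact hβ (hsome h.symm)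
  have A₃ := A₂.recolor_some (u := x) (v := y) (α := γ) (fun z h => by
      rw [recolor_apply, if_neg (by grind)] at h
      exact hxγ z h) (fun z h => by
      obtain rfl := hypend₂ z _ h
      rw [recolor_apply, if_pos (by grind)] at h
      exact hγν (hsome h.symm)) hnr
  set d := recolor (recolor (recolor c x w none) y y' (some ν)) x y (some γ) with hd
  have hdval : ∀ a b, d s(a, b) = if a = x ∧ b = y ∨ a = y ∧ b = x then some γ else
      if a = y ∧ b = y' ∨ a = y' ∧ b = y then some ν else
      if a = x ∧ b = w ∨ a = w ∧ b = x then none else c s(a, b) := by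
    intro a b
    rw [hd, recolor_apply, recolor_apply, recolor_apply]
  have hγk := hF.lt hγ
  have hνk := hF.lt hq
  have hD : IsFullAcyclicColoring (G.deleteEdges {s(x, w)}) (G.maxDegree + 1) d := by
    refine ⟨A₃, fun u v a h => ?_, fun u v a h => ?_, fun u v h => ?_⟩
    · rw [hdval] at h
      rw [deleteEdges_pair_adj]
      split_ifs at h with h₁ h₂ h₃
      · rcases h₁ with ⟨rfl, rfl⟩ | ⟨rfl, rfl⟩
        exacts [⟨hxy, by grind⟩, ⟨hxy.symm, by grind⟩]
      · rcases h₂ with ⟨rfl, rfl⟩ | ⟨rfl, rfl⟩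
        exacts [⟨hyy', by grind⟩, ⟨hyy'.symm, by grind⟩]
      · exact ⟨(deleteEdges_pair_adj.1 (hF.adj h)).1, h₃⟩
    · rw [hdval] at h
      split_ifs at h
      exacts [hsome h ▸ hγk, hsome h ▸ hνk, hF.lt h]
    · rw [deleteEdges_pair_adj] at h
      rw [hdval]
      split_ifs with h₁ h₂ h₃
      exacts [⟨_, rfl⟩, ⟨_, rfl⟩, absurd h₃ h.2, hF.colored (deleteEdges_pair_adj.2 ⟨h.1, h₁⟩)]
  have hdτ : d s(w, w') = some τ := by
    rw [hdval, if_neg (by grind), if_neg (by grind), if_neg (by grind), hτ]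
  have hτμν : τ = μ ∨ τ = ν := by
    obtain ⟨z, hxz, hz3, hz⟩ := hD.exists_three_le_degree hmin hw2 hxw hww' hw'x hdτ
    have hzy : z ≠ y := by rintro rfl; omega
    have hzw : z ≠ w := by rintro rfl; omega
    rw [hdval, if_neg (by grind), if_neg (by grind), if_neg (by grind)] at hz
    rcases hbig z hxz hz3 with rfl | rfl
    · exact .inl (hsome (hz.symm.trans hp))
    · exact .inr (hsome (hz.symm.trans hq))
  have hτγ : τ ≠ γ := by rcases hτμν with rfl | rfl; exacts [hγμ.symm, hγν.symm]
  have hτy' : ∀ z, z ≠ y → c s(y', z) ≠ some τ := by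
    rcases hτμν with rfl | rfl
    exacts [hμy', hνy']
  obtain ⟨α, hαk, hατ, hα⟩ := hF.exists_fresh hxy τ
  have hαγ : α ≠ γ := by rintro rfl; exact hα w hγ
  have hαd : ∀ z, d s(x, z) ≠ some α := by
    intro z h
    rw [hdval] at h
    split_ifs at h
    · exact hαγ (hsome h.symm)
    · grind
    · exact hα z h
  have hE := hF.recolor_pendant hy2 hxy hyy' hy'x (hF.lt hτ) hτy'
  have r₁ := hE.reachable hmin hy2 hxy hyy' hy'x (μ := τ) (α := α)
    (by simp [recolor_apply]) hαk hατ (fun z h => by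
      rw [recolor_apply, if_neg (by grind)] at h
      exact hα z h)
  have r₂ := hD.reachable hmin hw2 hxw hww' hw'x hdτ hαk hατ hαd
  set b := recolor (recolor c x w none) y y' none with hb
  have hbval : ∀ u v, b s(u, v) = if u = y ∧ v = y' ∨ u = y' ∧ v = y then none else
      if u = x ∧ v = w ∨ u = w ∧ v = x then none else c s(u, v) := by
    intro u v
    rw [hb, recolor_apply, recolor_apply]
  have hble : ∀ u v i, b s(u, v) = some i → c s(u, v) = some i := by
    intro u v i h
    rw [hbval] at h
    split_ifs at h
    exact h
  have hb' : IsAcyclicColoring b := A₁.recolor_none y y'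
  have hxwτ : ¬ (c s(x, w) = some τ ∨ c s(x, w) = some α) := by
    rw [hγ]
    rintro (h | h)
    exacts [hτγ (hsome h).symm, hαγ (hsome h).symm]
  have hwxτ : ¬ (c s(w, x) = some τ ∨ c s(w, x) = some α) := by rwa [Sym2.eq_swap]
  have r₁' := (reachable_of_pendant (H := bichromaticGraph (recolor c y y' (some τ)) τ α)
    (H' := bichromaticGraph b τ α) (y' := y') hxy.ne
    (fun z hz => hz.2.elim (hE.eq_of_pendant hy2 hxy hyy' hy'x z _)
      (hE.eq_of_pendant hy2 hxy hyy' hy'x z _)) (fun u v hu hv huv => by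
      refine ⟨huv.1, ?_⟩
      have := huv.2
      rw [recolor_apply, if_neg (by grind)] at this
      rw [hbval, if_neg (by grind), if_neg]
      · exact this
      · rintro (⟨rfl, rfl⟩ | ⟨rfl, rfl⟩)
        exacts [hxwτ this, hwxτ this]) r₁).2 rfl
  have r₂' := (reachable_of_pendant (H := bichromaticGraph d τ α)
    (H' := bichromaticGraph b τ α) (y' := y') hxy.ne
    (fun z hz => by
      by_contra hzy'
      have := hz.2
      rw [hdval] at this
      split_ifs at this with h₁ h₂ h₃
      · rcases this with h | h
        exacts [hτγ (hsome h).symm, hαγ (hsome h).symm]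
      · grind
      · simp at this
      · exact hzy' (this.elim (hypend z _) (hypend z _))) (fun u v hu hv huv => by
      refine ⟨huv.1, ?_⟩
      have := huv.2
      rw [hdval, if_neg (by grind), if_neg (by grind)] at this
      rw [hbval, if_neg (by grind)]
      exact this) r₂).1 hwy
  refine not_reachable_of_three_leaves hb'.eq_or_eq_or_eq hy'x.symm hwx.symm hwy'.symm
    (fun s t hs ht => ?_) (fun s t hs ht => ?_) (fun s t hs ht => ?_) r₁' r₂'
  · have h : ∀ z, (bichromaticGraph b τ α).Adj x z → b s(x, z) = some τ := fun z hz =>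
      hz.2.resolve_right fun h => hα z (hble _ _ _ h)
    exact hb'.proper (h s hs) (h t ht)
  · have h : ∀ z, (bichromaticGraph b τ α).Adj y' z → b s(y', z) = some α := by
      refine fun z hz => hz.2.resolve_left fun h => hτy' z ?_ (hble _ _ _ h)
      rintro rfl
      rw [hbval, if_pos (by grind)] at h
      simp at h
    exact hb'.proper (h s hs) (h t ht)
  · have h : ∀ z, (bichromaticGraph b τ α).Adj w z → z = w' := by
      intro z hz
      have hzx : z ≠ x := by
        rintro rfl
        have := hz.2
        rw [hbval, if_neg (by grind), if_pos (by grind)] at this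
        simp at this
      exact (hz.2.elim (fun h => hwnbr z _ (hble _ _ _ h))
        (fun h => hwnbr z _ (hble _ _ _ h))).resolve_left hzx
    rw [h s hs, h t ht]

end AEC
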